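/- In the setting of the primal-dual dynamical system, suppose a primal-dual solution exists and let t ↦ (x(t), λ(t)) be a solution of the system. If r = 0, or r = 1, or (r ∈ (0,1) and the trajectory t ↦ (x(t), λ(t)) is bounded), then (x(t), λ(t)) converges weakly, as t → ∞, to a primal-dual solution of the linearly constrained minimization problem. -/

import Mathlib

open Filter Topology Set

theorem antitoneOn_Ici_of_hasDerivAt_nonpos {G G' : ℝ → ℝ} {T : ℝ}
    (hG : ∀ t ≥ T, HasDerivAt G (G' t) t) (h : ∀ t ≥ T, G' t ≤ 0) : AntitoneOn G (Ici T) :=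
  antitoneOn_of_hasDerivWithinAt_nonpos (convex_Ici T)
    (fun t ht => (hG t ht).continuousAt.continuousWithinAt)
    (fun t ht => (hG t (interior_subset ht)).hasDerivWithinAt)
    (fun t ht => h t (interior_subset ht))

/-- An eventually nonincreasing real function bounded below converges at infinity. -/
theorem exists_tendsto_of_antitoneOn_Ici {G : ℝ → ℝ} {T m : ℝ} (hG : AntitoneOn G (Ici T))
    (hm : ∀ t ≥ T, m ≤ G t) : ∃ L, Tendsto G atTop (𝓝 L) := by
  have hanti : Antitone fun t => G (max t T) := fun s t hst =>
    hG (mem_Ici.2 (le_max_right _ _)) (mem_Ici.2 (le_max_right _ _)) (max_le_max_right T hst)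
  refine ⟨_, (tendsto_atTop_ciInf hanti ⟨m, ?_⟩).congr' ?_⟩
  · rintro _ ⟨t, rfl⟩
    exact hm _ (le_max_right _ _)
  · filter_upwards [eventually_ge_atTop T] with t ht
    simp [max_eq_left ht]

/-- If `G` dissipates `D`, and `F` grows at most like `D` while being controlled by `t * D t`,
then `G` converges and `F` vanishes at infinity. -/
theorem tendsto_of_dissipation {F F' G G' D : ℝ → ℝ} {T K k : ℝ} (hT : 0 < T) (hK : 0 ≤ K)
    (hk : 0 < k) (hG : ∀ t ≥ T, HasDerivAt G (G' t) t) (hF : ∀ t ≥ T, HasDerivAt F (F' t) t)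
    (hGD : ∀ t ≥ T, G' t ≤ -D t) (hFD : ∀ t ≥ T, F' t ≤ K * D t)
    (hG0 : ∀ t ≥ T, 0 ≤ G t) (hF0 : ∀ t ≥ T, 0 ≤ F t) (hFt : ∀ t ≥ T, k * F t ≤ t * D t) :
    (∃ L, Tendsto G atTop (𝓝 L)) ∧ Tendsto F atTop (𝓝 0) := by
  have hD0 : ∀ t ≥ T, 0 ≤ D t := fun t ht =>
    nonneg_of_mul_nonneg_right ((mul_nonneg hk.le (hF0 t ht)).trans (hFt t ht))
      (hT.trans_le ht)
  obtain ⟨LG, hLG⟩ := exists_tendsto_of_antitoneOn_Ici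
    (antitoneOn_Ici_of_hasDerivAt_nonpos hG fun t ht => by linarith [hGD t ht, hD0 t ht]) hG0
  obtain ⟨LS, hLS⟩ := exists_tendsto_of_antitoneOn_Ici (G := fun t => F t + K * G t) (m := 0)
    (antitoneOn_Ici_of_hasDerivAt_nonpos (fun t ht => (hF t ht).add ((hG t ht).const_mul K))
      fun t ht => by nlinarith [hGD t ht, hFD t ht])
    fun t ht => add_nonneg (hF0 t ht) (mul_nonneg hK (hG0 t ht))
  have hLF : Tendsto F atTop (𝓝 (LS - K * LG)) := by
    simpa using hLS.sub (hLG.const_mul K)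
  have hL0 : 0 ≤ LS - K * LG :=
    ge_of_tendsto hLF ((eventually_ge_atTop T).mono hF0)
  refine ⟨⟨LG, hLG⟩, ?_⟩
  rcases hL0.eq_or_lt with h | hpos
  · rwa [← h] at hLF
  exfalso
  obtain ⟨S, hS⟩ := eventually_atTop.1 (hLF.eventually (lt_mem_nhds (half_lt_self hpos)))
  set d := k * ((LS - K * LG) / 2) with hd
  have hdpos : 0 < d := by positivity
  have hlog : AntitoneOn (fun t => G t + d * Real.log t) (Ici (max S T)) := by
    refine antitoneOn_Ici_of_hasDerivAt_nonpos (fun t ht => (hG t (le_of_max_le_right ht)).add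
      ((Real.hasDerivAt_log (hT.trans_le (le_of_max_le_right ht)).ne').const_mul d))
      fun t ht => ?_
    have ht0 : 0 < t := hT.trans_le (le_of_max_le_right ht)
    have h1 : d ≤ t * D t := (mul_le_mul_of_nonneg_left (hS t (le_of_max_le_left ht)).le hk.le).trans
      (hFt t (le_of_max_le_right ht))
    have h2 : d * t⁻¹ ≤ D t := by
      rw [← div_eq_mul_inv, div_le_iff₀ ht0]; linarith
    linarith [hGD t (le_of_max_le_right ht)]
  have htop : Tendsto (fun t => G t + d * Real.log t) atTop atTop :=
    hLG.add_atTop (Real.tendsto_log_atTop.const_mul_atTop hdpos)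
  obtain ⟨t, ht, htM⟩ := ((htop.eventually_gt_atTop _).and (eventually_ge_atTop (max S T))).exists
  exact absurd (hlog self_mem_Ici (mem_Ici.2 htM) htM) (not_le.2 ht)

section
variable {H : Type*} [NormedAddCommGroup H] [InnerProductSpace ℝ H]

/-- Minty's trick for a continuous operator. -/
theorem eq_zero_of_forall_inner_nonneg {V : H → H} (hV : Continuous V) {a : H}
    (h : ∀ y, 0 ≤ inner ℝ (V y) (y - a)) : V a = 0 := by
  have key : ∀ v, 0 ≤ inner ℝ (V a) v := by
    intro v
    have hc : Tendsto (fun s : ℝ => inner ℝ (V (a + s • v)) v) (𝓝[>] 0) (𝓝 (inner ℝ (V a) v)) := by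
      have : Continuous fun s : ℝ => inner ℝ (V (a + s • v)) v := by fun_prop
      simpa using (this.tendsto 0).mono_left nhdsWithin_le_nhds
    refine ge_of_tendsto hc ?_
    filter_upwards [self_mem_nhdsWithin] with s hs
    have h1 := h (a + s • v)
    rw [add_sub_cancel_left, inner_smul_right] at h1
    exact nonneg_of_mul_nonneg_right h1 hs
  have := key (-V a)
  rw [inner_neg_right, real_inner_self_eq_norm_sq] at this
  exact norm_eq_zero.1 (by nlinarith [norm_nonneg (V a)])

/-- The velocity of a differentiable path and that of its image under a monotone operator form a
nonnegative angle. -/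
theorem inner_deriv_nonneg_of_monotone {z w : ℝ → H} {z' w' : H} {t : ℝ}
    (hz : HasDerivAt z z' t) (hw : HasDerivAt w w' t)
    (h : ∀ s, 0 ≤ inner ℝ (w s - w t) (z s - z t)) : 0 ≤ inner ℝ z' w' := by
  refine ge_of_tendsto ((hasDerivAt_iff_tendsto_slope.1 hz).inner
    (hasDerivAt_iff_tendsto_slope.1 hw)) (Eventually.of_forall fun s => ?_)
  simp only [slope_def_module, inner_smul_left, inner_smul_right, ← mul_assoc]
  rw [real_inner_comm]
  exact mul_nonneg (mul_self_nonneg _) (h s)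

variable [CompleteSpace H]

/-- Bounded families in a Hilbert space converge weakly along ultrafilters. -/
theorem exists_weak_limit_ultrafilter {ι : Type*} (U : Ultrafilter ι) {z : ι → H} {M : ℝ}
    (hz : ∀ᶠ t in U, ‖z t‖ ≤ M) :
    ∃ a : H, ∀ y, Tendsto (fun t => inner ℝ (z t) y) U (𝓝 (inner ℝ a y)) := by
  let g : ι → WeakDual ℝ H := fun t => StrongDual.toWeakDual (InnerProductSpace.toDual ℝ H (z t))
  have hmem : g ⁻¹' (WeakDual.toStrongDual ⁻¹' Metric.closedBall 0 M) ∈ U := by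
    filter_upwards [hz] with t ht
    simpa [g] using ht
  obtain ⟨l, -, hl⟩ := (WeakDual.isCompact_closedBall (𝕜 := ℝ) (0 : StrongDual ℝ H) M).ultrafilter_le_nhds
    (U.map g) (le_principal_iff.2 hmem)
  refine ⟨(InnerProductSpace.toDual ℝ H).symm (WeakDual.toStrongDual l), fun y => ?_⟩
  rw [InnerProductSpace.toDual_symm_apply]
  exact ((WeakDual.eval_continuous y).tendsto l).comp hl

/-- Opial-type lemma: a trajectory along which a continuous monotone operator vanishes and whose
distance to each zero converges is weakly convergent to a zero. -/
theorem exists_weak_limit_of_monotone {V : H → H} (hV : Continuous V)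
    (hmono : ∀ a c, 0 ≤ inner ℝ (V a - V c) (a - c)) {z : ℝ → H}
    (hVz : Tendsto (fun t => V (z t)) atTop (𝓝 0)) (hex : ∃ a, V a = 0)
    (hdist : ∀ a, V a = 0 → ∃ L, Tendsto (fun t => ‖z t - a‖ ^ 2) atTop (𝓝 L)) :
    ∃ a, V a = 0 ∧ ∀ y, Tendsto (fun t => inner ℝ (z t) y) atTop (𝓝 (inner ℝ a y)) := by
  obtain ⟨M, hM⟩ : ∃ M, ∀ᶠ t in atTop, ‖z t‖ ≤ M := by
    obtain ⟨a, ha⟩ := hex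
    obtain ⟨L, hL⟩ := hdist a ha
    refine ⟨(L + 1 + 1) + ‖a‖, ?_⟩
    filter_upwards [hL.eventually (gt_mem_nhds (lt_add_one L))] with t ht
    have := norm_sub_norm_le (z t) a
    nlinarith [sq_nonneg (‖z t - a‖ - 1)]
  have hcluster : ∀ U : Ultrafilter ℝ, (U : Filter ℝ) ≤ atTop → ∃ a, V a = 0 ∧
      ∀ y, Tendsto (fun t => inner ℝ (z t) y) U (𝓝 (inner ℝ a y)) := by
    intro U hU
    obtain ⟨a, ha⟩ := exists_weak_limit_ultrafilter U (hM.filter_mono hU)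
    refine ⟨a, eq_zero_of_forall_inner_nonneg hV fun y => ?_, ha⟩
    have h0 : Tendsto (fun t => inner ℝ (V (z t)) (y - z t)) U (𝓝 0) := by
      refine squeeze_zero_norm' (a := fun t => ‖V (z t)‖ * (‖y‖ + M)) ?_ ?_
      · filter_upwards [hM.filter_mono hU] with t ht
        refine (norm_inner_le_norm _ _).trans ?_
        gcongr
        exact (norm_sub_le _ _).trans (by gcongr)
      · simpa using ((hVz.mono_left hU).norm.mul_const (‖y‖ + M))
    have h1 : Tendsto (fun t => inner ℝ (V y) (y - z t)) U (𝓝 (inner ℝ (V y) (y - a))) := by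
      simp only [inner_sub_right]
      refine tendsto_const_nhds.sub ?_
      simpa only [real_inner_comm] using ha (V y)
    refine ge_of_tendsto (by simpa using h1.sub h0) (Eventually.of_forall fun t => ?_)
    simpa only [inner_sub_left] using hmono y (z t)
  have huniq : ∀ U U' : Ultrafilter ℝ, (U : Filter ℝ) ≤ atTop → (U' : Filter ℝ) ≤ atTop →
      ∀ a a', V a = 0 → V a' = 0 → (∀ y, Tendsto (fun t => inner ℝ (z t) y) U (𝓝 (inner ℝ a y))) →
      (∀ y, Tendsto (fun t => inner ℝ (z t) y) U' (𝓝 (inner ℝ a' y))) → a = a' := by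
    intro U U' hU hU' a a' h h' hUa hUa'
    obtain ⟨L, hL⟩ := hdist a h
    obtain ⟨L', hL'⟩ := hdist a' h'
    have hlim : Tendsto (fun t => inner ℝ (z t) (a - a')) atTop
        (𝓝 ((L' - L + ‖a‖ ^ 2 - ‖a'‖ ^ 2) / 2)) := by
      refine ((((hL'.sub hL).add_const (‖a‖ ^ 2)).sub_const (‖a'‖ ^ 2)).div_const 2).congr
        fun t => ?_
      rw [norm_sub_sq_real, norm_sub_sq_real, inner_sub_right]
      ring
    have e1 := tendsto_nhds_unique (hUa _) (hlim.mono_left hU)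
    have e2 := tendsto_nhds_unique (hUa' _) (hlim.mono_left hU')
    have e3 : inner ℝ (a - a') (a - a') = 0 := by rw [inner_sub_left, e1, e2, sub_self]
    exact sub_eq_zero.1 (inner_self_eq_zero.1 e3)
  obtain ⟨a, ha, haU⟩ := hcluster (Ultrafilter.of atTop) (Ultrafilter.of_le _)
  refine ⟨a, ha, fun y => (tendsto_iff_ultrafilter _ _ _).2 fun U hU => ?_⟩
  obtain ⟨a', ha', haU'⟩ := hcluster U hU
  rw [huniq _ U (Ultrafilter.of_le _) hU a a' ha ha' haU haU']
  exact haU' y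

/-- The gradient of a differentiable convex function is monotone. -/
theorem ConvexOn.inner_gradient_sub_nonneg {f : H → ℝ} (hconv : ConvexOn ℝ univ f)
    (hf : Differentiable ℝ f) (x y : H) : 0 ≤ inner ℝ (gradient f x - gradient f y) (x - y) := by
  have hline : ∀ s : ℝ, HasDerivAt (fun s : ℝ => f (AffineMap.lineMap y x s))
      (inner ℝ (gradient f (AffineMap.lineMap y x s)) (x - y)) s := fun s => by
    have := (hf (AffineMap.lineMap y x s)).hasGradientAt.hasFDerivAt.comp_hasDerivAt s
      (AffineMap.hasDerivAt_lineMap (a := y) (b := x))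
    simpa [Function.comp_def] using this
  have hc : ConvexOn ℝ univ (fun s : ℝ => f (AffineMap.lineMap y x s)) :=
    hconv.comp_affineMap (AffineMap.lineMap y x)
  have := hc.monotoneOn_deriv (fun s _ => (hline s).differentiableAt) (mem_univ 0) (mem_univ 1)
    zero_le_one
  rw [(hline 0).deriv, (hline 1).deriv] at this
  simpa [inner_sub_left] using this
end

theorem tendsto_zero_of_norm_sq_le {ι E : Type*} [NormedAddCommGroup E] {l : Filter ι} {u : ι → E}
    {F : ι → ℝ}
    (h : ∀ t, ‖u t‖ ^ 2 ≤ F t) (hF : Tendsto F l (𝓝 0)) : Tendsto u l (𝓝 0) :=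
  squeeze_zero_norm (fun t => Real.le_sqrt_of_sq_le (h t)) (by simpa using hF.sqrt)

section
variable {H : Type*} [NormedAddCommGroup H] [InnerProductSpace ℝ H]

theorem abs_inner_smul_le (m : ℝ) (v w : H) :
    |m * inner ℝ v w| ≤ (‖v‖ ^ 2 + m ^ 2 * ‖w‖ ^ 2) / 2 := by
  have h := abs_real_inner_le_norm v (m • w)
  rw [inner_smul_right, norm_smul] at h
  have h2 : (|m| * ‖w‖) ^ 2 = m ^ 2 * ‖w‖ ^ 2 := by rw [mul_pow, sq_abs]
  rw [Real.norm_eq_abs] at h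
  nlinarith [sq_nonneg (‖v‖ - |m| * ‖w‖)]

/-- Growth of the kinetic part of the energy, in terms of the dissipated quantity. -/
theorem kinetic_deriv_le {α ℓ a i p p₁ m κ : ℝ} (v w w₁ : H) (hp : 0 < p) (hm : 0 < m)
    (hp₁ : ℓ ≤ p₁) (hp₁α : p₁ ≤ α) (hi : 0 < i) (hκ0 : 0 ≤ κ) (hκ : κ ≤ 2 * a)
    (hvw : 0 ≤ inner ℝ v w₁) :
    inner ℝ (p • v + (p * m / 2) • w)
        ((p₁ - α) • v - (p * m / 2) • w₁ + (m * (i - κ) / 2 - m * i) • w)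
      + inner ℝ ((p * m) • w) ((m * (i - κ)) • w + (p * m) • w₁) / 4
      ≤ (α - ℓ + i + 2 * a) / 4 * (p * (‖v‖ ^ 2 + m ^ 2 * ‖w‖ ^ 2)) := by
  have e : inner ℝ (p • v + (p * m / 2) • w)
        ((p₁ - α) • v - (p * m / 2) • w₁ + (m * (i - κ) / 2 - m * i) • w)
      + inner ℝ ((p * m) • w) ((m * (i - κ)) • w + (p * m) • w₁) / 4
      = p * (-(α - p₁) * ‖v‖ ^ 2 - (α - p₁ + i + κ) / 2 * (m * inner ℝ v w)
        - κ / 2 * (m ^ 2 * ‖w‖ ^ 2)) - p * p * m / 2 * inner ℝ v w₁ := by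
    simp only [inner_add_left, inner_add_right, inner_sub_right, real_inner_smul_left,
      real_inner_smul_right, real_inner_self_eq_norm_sq, real_inner_comm v w]
    ring
  rw [e]
  have h1 := neg_le_of_abs_le (abs_inner_smul_le m v w)
  have h2 : 0 ≤ p * p * m / 2 * inner ℝ v w₁ := by positivity
  have hW : 0 ≤ m ^ 2 * ‖w‖ ^ 2 := by positivity
  set W := m ^ 2 * ‖w‖ ^ 2
  set S := m * inner ℝ v w
  have hP : 0 ≤ ‖v‖ ^ 2 := by positivity
  set P := ‖v‖ ^ 2
  have h3 : -(α - p₁) * P - (α - p₁ + i + κ) / 2 * S - κ / 2 * W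
      ≤ (α - ℓ + i + 2 * a) / 4 * (P + W) := by
    have k1 : -((α - p₁ + i + κ) / 2 * S) ≤ (α - p₁ + i + κ) / 2 * ((P + W) / 2) := by
      nlinarith
    have k2 : (α - p₁ + i + κ) / 2 * ((P + W) / 2) ≤ (α - ℓ + i + 2 * a) / 2 * ((P + W) / 2) := by
      gcongr
    nlinarith [mul_nonneg (sub_nonneg.2 hp₁α) hP, mul_nonneg hκ0 hW]
  nlinarith [mul_le_mul_of_nonneg_left h3 hp.le]

/-- Dissipation of the full energy. -/
theorem energy_deriv_le {α ℓ a c i p p₁ p₂ m κ η M : ℝ} (v w w₁ h : H) (hp : 0 < p) (hm : 0 < m)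
    (hα : α = c + ℓ + a) (hi : i = c - a) (hc : 0 ≤ c) (hp₁ : ℓ ≤ p₁) (hη : p₁ ≤ ℓ + η)
    (hηa : 4 * η ≤ a) (hηκ : 4 * η ≤ κ) (hκ : κ ≤ 2 * a)
    (hvw : 0 ≤ inner ℝ v w₁) (hwh : 0 ≤ inner ℝ w h) (hM : 0 ≤ p₂ * (‖h‖ ^ 2 - M)) :
    inner ℝ (p • v + (p * m / 2) • w)
        ((p₁ - α) • v - (p * m / 2) • w₁ + (m * (i - κ) / 2 - m * i) • w)
      + inner ℝ ((p * m) • w) ((m * (i - κ)) • w + (p * m) • w₁) / 4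
      + c * (inner ℝ (p • v + (p * m) • w) v
        + inner ℝ ((p₁ - α) • v + (m * (i - κ) - m * i) • w) h
        + (α - p₁) * inner ℝ h v - p₂ / 2 * ‖h‖ ^ 2) + c * M / 2 * p₂
      ≤ -(η * (p * (‖v‖ ^ 2 + m ^ 2 * ‖w‖ ^ 2))) := by
  have e : inner ℝ (p • v + (p * m / 2) • w)
        ((p₁ - α) • v - (p * m / 2) • w₁ + (m * (i - κ) / 2 - m * i) • w)
      + inner ℝ ((p * m) • w) ((m * (i - κ)) • w + (p * m) • w₁) / 4
      + c * (inner ℝ (p • v + (p * m) • w) v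
        + inner ℝ ((p₁ - α) • v + (m * (i - κ) - m * i) • w) h
        + (α - p₁) * inner ℝ h v - p₂ / 2 * ‖h‖ ^ 2) + c * M / 2 * p₂
      = p * (-(a - (p₁ - ℓ)) * ‖v‖ ^ 2 - (κ - (p₁ - ℓ)) / 2 * (m * inner ℝ v w)
        - κ / 2 * (m ^ 2 * ‖w‖ ^ 2)) - p * p * m / 2 * inner ℝ v w₁
        - c * κ * m * inner ℝ w h - c / 2 * (p₂ * (‖h‖ ^ 2 - M)) := by
    subst hα hi
    simp only [inner_add_left, inner_add_right, inner_sub_right, real_inner_smul_left,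
      real_inner_smul_right, real_inner_self_eq_norm_sq, real_inner_comm v w, real_inner_comm v h]
    ring
  rw [e]
  have hη0 : 0 ≤ η := by linarith
  have hκ0 : 0 ≤ κ := by linarith
  have h1 := neg_le_of_abs_le (abs_inner_smul_le m v w)
  have h2 : 0 ≤ p * p * m / 2 * inner ℝ v w₁ := by positivity
  have h4 : 0 ≤ c * κ * m * inner ℝ w h := by positivity
  have h5 : 0 ≤ c / 2 * (p₂ * (‖h‖ ^ 2 - M)) := by positivity
  have hW : 0 ≤ m ^ 2 * ‖w‖ ^ 2 := by positivity
  set W := m ^ 2 * ‖w‖ ^ 2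
  set S := m * inner ℝ v w
  have hP : 0 ≤ ‖v‖ ^ 2 := by positivity
  set P := ‖v‖ ^ 2
  have h3 : -(a - (p₁ - ℓ)) * P - (κ - (p₁ - ℓ)) / 2 * S - κ / 2 * W ≤ -(η * (P + W)) := by
    have k1 : -((κ - (p₁ - ℓ)) / 2 * S) ≤ (κ - (p₁ - ℓ)) / 2 * ((P + W) / 2) := by
      nlinarith
    have k2 : (κ - (p₁ - ℓ)) / 2 * ((P + W) / 2) ≤ κ / 2 * ((P + W) / 2) := by
      gcongr; linarith
    have k3 : (η - (a - (p₁ - ℓ)) + κ / 4) * P ≤ 0 :=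
      mul_nonpos_of_nonpos_of_nonneg (by linarith) hP
    have k4 : (η - κ / 4) * W ≤ 0 := mul_nonpos_of_nonpos_of_nonneg (by linarith) hW
    linarith
  nlinarith [mul_le_mul_of_nonneg_left h3 hp.le]

/-- Long-time behaviour of `z'' + (α / p) z' + θ p β w' + β w = 0` when `w` is monotonically
related to `z` and vanishes at `zs` in the monotone sense. -/
theorem tendsto_of_inertial_system {t₀ α θ ℓ γ p₀ β₀ M : ℝ} {p p₁ p₂ β β₁ : ℝ → ℝ}
    {z z₁ z₂ w w₁ : ℝ → H} {zs : H} (ht₀ : 0 < t₀) (hθ : 0 < θ) (hℓ0 : 0 ≤ ℓ)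
    (ha : 0 < α - ℓ - 1 / θ) (hκ : 1 / θ - 2 * ℓ ≤ α - ℓ - 1 / θ) (hγ : γ < 1 / θ)
    (hp₀ : 0 < p₀) (hβ₀ : 0 < β₀) (hM0 : 0 ≤ M)
    (hp₀p : ∀ t ≥ t₀, p₀ ≤ p t) (hpt : ∀ᶠ t in atTop, p t ≤ t)
    (hp : ∀ t ≥ t₀, HasDerivAt p (p₁ t) t) (hp₁ : ∀ t ≥ t₀, HasDerivAt p₁ (p₂ t) t)
    (hlim : Tendsto p₁ atTop (𝓝 ℓ)) (hℓ : ∀ t ≥ t₀, ℓ ≤ p₁ t)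
    (hβ₀β : ∀ t ≥ t₀, β₀ ≤ β t) (hβ : ∀ t ≥ t₀, HasDerivAt β (β₁ t) t)
    (hβ₁ : ∀ t ≥ t₀, 0 ≤ β₁ t)
    (hgrowth : ∀ t ≥ t₀, p t * (β₁ t / β t) + 2 * p₁ t ≤ γ)
    (hz : ∀ t ≥ t₀, HasDerivAt z (z₁ t) t) (hz₁ : ∀ t ≥ t₀, HasDerivAt z₁ (z₂ t) t)
    (hw : ∀ t ≥ t₀, HasDerivAt w (w₁ t) t)
    (heq : ∀ t ≥ t₀, z₂ t + (α / p t) • z₁ t + (θ * p t * β t) • w₁ t + β t • w t = 0)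
    (hzw : ∀ t ≥ t₀, 0 ≤ inner ℝ (z₁ t) (w₁ t)) (hws : ∀ t ≥ t₀, 0 ≤ inner ℝ (w t) (z t - zs))
    (hM : ∀ t ≥ t₀, 0 ≤ p₂ t * (‖z t - zs‖ ^ 2 - M)) :
    (∃ L, Tendsto (fun t => ‖z t - zs‖ ^ 2) atTop (𝓝 L)) ∧ Tendsto w atTop (𝓝 0) := by
  obtain ⟨i, hi⟩ : ∃ i, i = 1 / θ := ⟨_, rfl⟩
  obtain ⟨c, hc⟩ : ∃ c, c = (α - ℓ + i) / 2 := ⟨_, rfl⟩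
  obtain ⟨a, haa⟩ : ∃ a, a = (α - ℓ - i) / 2 := ⟨_, rfl⟩
  have hipos : 0 < i := hi ▸ by positivity
  rw [← hi] at ha hκ hγ
  have hapos : 0 < a := by linarith
  have hcpos : 0 < c := by linarith
  obtain ⟨η, hη0, hηa, hηγ⟩ : ∃ η, 0 < η ∧ 4 * η ≤ a ∧ 4 * η ≤ i - γ :=
    ⟨min (a / 4) ((i - γ) / 4), lt_min (by linarith) (by linarith),
      by linarith [min_le_left (a / 4) ((i - γ) / 4)],
      by linarith [min_le_right (a / 4) ((i - γ) / 4)]⟩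
  obtain ⟨T₁, hT₁⟩ := eventually_atTop.1 (hpt.and (hlim.eventually (gt_mem_nhds
    (lt_add_of_pos_right ℓ hη0))))
  set T := max t₀ T₁
  have hTt₀ : ∀ t ≥ T, t₀ ≤ t := fun t ht => (le_max_left _ _).trans ht
  have hTT₁ : ∀ t ≥ T, T₁ ≤ t := fun t ht => (le_max_right _ _).trans ht
  let m : ℝ → ℝ := fun t => θ * p t * β t
  let κ : ℝ → ℝ := fun t => i - (p t * (β₁ t / β t) + 2 * p₁ t)
  have hppos : ∀ t ≥ t₀, 0 < p t := fun t ht => hp₀.trans_le (hp₀p t ht)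
  have hβpos : ∀ t ≥ t₀, 0 < β t := fun t ht => hβ₀.trans_le (hβ₀β t ht)
  have hmpos : ∀ t ≥ t₀, 0 < m t := fun t ht =>
    mul_pos (mul_pos hθ (hppos t ht)) (hβpos t ht)
  have hκη : ∀ t ≥ t₀, 4 * η ≤ κ t := fun t ht => by
    have := hgrowth t ht
    simp only [κ]; linarith
  have hκa : ∀ t ≥ t₀, κ t ≤ 2 * a := fun t ht => by
    have := mul_nonneg (hppos t ht).le (div_nonneg (hβ₁ t ht) (hβpos t ht).le)
    have := hℓ t ht
    simp only [κ]; linarith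
  have hq : ∀ t ≥ t₀, HasDerivAt (fun t => p t * m t) (m t * (i - κ t)) t := fun t ht => by
    have h := (hp t ht).mul (((hp t ht).const_mul θ).mul (hβ t ht))
    refine h.congr_deriv ?_
    have := (hβpos t ht).ne'
    simp only [m, κ, Pi.mul_apply]
    field_simp
    ring
  have hpz : ∀ t ≥ t₀, p t • z₂ t = -(α • z₁ t) - (p t * m t) • w₁ t - (m t * i) • w t := by
    intro t ht
    have h0 : z₂ t = -((α / p t) • z₁ t) - (θ * p t * β t) • w₁ t - β t • w t := by
      have := heq t ht
      rw [← sub_eq_zero, ← this]; abel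
    have h1 := (hppos t ht).ne'
    have k1 : p t * (α / p t) = α := mul_div_cancel₀ α h1
    have k2 : p t * β t = m t * i := by simp only [m, hi]; field_simp
    rw [h0, smul_sub, smul_sub, smul_neg, smul_smul, smul_smul, smul_smul, k1, k2]
  let u : ℝ → H := fun t => p t • z₁ t + (p t * m t / 2) • w t
  have hu : ∀ t ≥ t₀, HasDerivAt u ((p₁ t - α) • z₁ t - (p t * m t / 2) • w₁ t
      + (m t * (i - κ t) / 2 - m t * i) • w t) t := fun t ht => by
    refine (((hp t ht).smul (hz₁ t ht)).add (((hq t ht).div_const 2).smul (hw t ht))).congr_deriv ?_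
    rw [hpz t ht]
    module
  have hqw : ∀ t ≥ t₀, HasDerivAt (fun t => (p t * m t) • w t)
      ((m t * (i - κ t)) • w t + (p t * m t) • w₁ t) t := fun t ht => by
    refine ((hq t ht).smul (hw t ht)).congr_deriv ?_
    module
  let y : ℝ → H := fun t => p t • z₁ t + (p t * m t) • w t
  have hy : ∀ t ≥ t₀, HasDerivAt y ((p₁ t - α) • z₁ t + (m t * (i - κ t) - m t * i) • w t) t :=
    fun t ht => by
      refine (((hp t ht).smul (hz₁ t ht)).add (hqw t ht)).congr_deriv ?_
      rw [hpz t ht]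
      module
  have hh : ∀ t ≥ t₀, HasDerivAt (fun t => z t - zs) (z₁ t) t := fun t ht => (hz t ht).sub_const zs
  let F : ℝ → ℝ := fun t => ‖u t‖ ^ 2 / 2 + ‖(p t * m t) • w t‖ ^ 2 / 8
  let Q : ℝ → ℝ := fun t => inner ℝ (y t) (z t - zs) + (α - p₁ t) * ‖z t - zs‖ ^ 2 / 2
  let G : ℝ → ℝ := fun t => F t + c * Q t + c * M / 2 * p₁ t
  let D : ℝ → ℝ := fun t => η * (p t * (‖z₁ t‖ ^ 2 + m t ^ 2 * ‖w t‖ ^ 2))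
  have hF : ∀ t ≥ t₀, HasDerivAt F _ t := fun t ht =>
    (((hu t ht).norm_sq.div_const 2).add ((hqw t ht).norm_sq.div_const 8))
  have hQ : ∀ t ≥ t₀, HasDerivAt Q _ t := fun t ht =>
    ((hy t ht).inner ℝ (hh t ht)).add
      (((((hp₁ t ht).const_sub α).mul (hh t ht).norm_sq)).div_const 2)
  have hG : ∀ t ≥ t₀, HasDerivAt G _ t := fun t ht =>
    ((hF t ht).add ((hQ t ht).const_mul c)).add ((hp₁ t ht).const_mul (c * M / 2))
  have hE : ∀ t ≥ T, c * a / 4 * ‖z t - zs‖ ^ 2 ≤ G t := by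
    intro t ht
    have ht0 := hTt₀ t ht
    have e : F t + c * Q t = ‖u t + c • (z t - zs)‖ ^ 2 / 2
        + c * (a - (p₁ t - ℓ)) / 2 * ‖z t - zs‖ ^ 2
        + c * (p t * m t) / 2 * inner ℝ (w t) (z t - zs) + ‖(p t * m t) • w t‖ ^ 2 / 8 := by
      simp only [F, Q, norm_add_sq_real, u, y, norm_smul, mul_pow, inner_add_left,
        real_inner_smul_left, real_inner_smul_right, Real.norm_eq_abs, sq_abs]
      rw [show α = c + ℓ + a by linarith]
      ring
    have h1 : 0 ≤ c * (p t * m t) / 2 * inner ℝ (w t) (z t - zs) := by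
      have := hws t ht0; have := hppos t ht0; have := hmpos t ht0; positivity
    have h2 : c * a / 4 ≤ c * (a - (p₁ t - ℓ)) / 2 := by
      nlinarith [(hT₁ t (hTT₁ t ht)).2]
    have h3 : 0 ≤ c * M / 2 * p₁ t := by
      have := hℓ0.trans (hℓ t ht0); positivity
    have h4 := mul_le_mul_of_nonneg_right h2 (sq_nonneg ‖z t - zs‖)
    have h5 := sq_nonneg ‖u t + c • (z t - zs)‖
    have h6 := sq_nonneg ‖(p t * m t) • w t‖
    simp only [G]
    linarith
  obtain ⟨⟨L, hGL⟩, hF0⟩ := tendsto_of_dissipation (F := F) (G := G) (D := D) (T := T) (k := η)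
    (K := (α - ℓ + i + 2 * a) / 4 / η) (ht₀.trans_le (le_max_left _ _))
    (div_nonneg (by linarith) hη0.le) hη0
    (fun t ht => hG t (hTt₀ t ht)) (fun t ht => hF t (hTt₀ t ht))
    (fun t ht => by
      have ht0 := hTt₀ t ht
      have := energy_deriv_le (z₁ t) (w t) (w₁ t) (z t - zs) (hppos t ht0) (hmpos t ht0)
        (by linarith : α = c + ℓ + a) (by linarith : i = c - a) hcpos.le (hℓ t ht0)
        (hT₁ t (hTT₁ t ht)).2.le hηa (hκη t ht0) (hκa t ht0) (hzw t ht0) (hws t ht0) (hM t ht0)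
      simp only [D]
      refine le_trans (le_of_eq ?_) this
      simp only [u, y]
      ring)
    (fun t ht => by
      have ht0 := hTt₀ t ht
      have := kinetic_deriv_le (α := α) (i := i) (z₁ t) (w t) (w₁ t) (hppos t ht0) (hmpos t ht0)
        (hℓ t ht0) (by linarith [(hT₁ t (hTT₁ t ht)).2]) hipos
        (by linarith [hκη t ht0]) (hκa t ht0) (hzw t ht0)
      simp only [D]
      have hK : ∀ s, (α - ℓ + i + 2 * a) / 4 / η * (η * s) = (α - ℓ + i + 2 * a) / 4 * s :=
        fun s => by field_simp
      rw [hK]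
      refine le_trans (le_of_eq ?_) this
      simp only [u]
      ring)
    (fun t ht => le_trans (by positivity) (hE t ht)) (fun t ht => by positivity)
    (fun t ht => by
      have ht0 := hTt₀ t ht
      have hpp := hppos t ht0
      have hpt := (hT₁ t (hTT₁ t ht)).1
      have hu2 : ‖u t‖ ^ 2 ≤ 2 * (p t ^ 2 * ‖z₁ t‖ ^ 2) + (p t * m t) ^ 2 * ‖w t‖ ^ 2 / 2 := by
        have h1 := parallelogram_law_with_norm ℝ (p t • z₁ t) ((p t * m t / 2) • w t)
        have h2 := mul_self_nonneg ‖p t • z₁ t - (p t * m t / 2) • w t‖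
        simp only [← sq, norm_smul, mul_pow, Real.norm_eq_abs, sq_abs] at h1 h2
        simp only [u]
        linarith
      have hFle : F t ≤ p t * (p t * (‖z₁ t‖ ^ 2 + m t ^ 2 * ‖w t‖ ^ 2)) := by
        simp only [F, norm_smul, mul_pow, Real.norm_eq_abs, sq_abs]
        have : 0 ≤ p t ^ 2 * m t ^ 2 * ‖w t‖ ^ 2 := by positivity
        nlinarith
      have hD0 : 0 ≤ p t * (‖z₁ t‖ ^ 2 + m t ^ 2 * ‖w t‖ ^ 2) := by positivity
      simp only [D]
      nlinarith [mul_le_mul_of_nonneg_right hpt hD0])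
  have hu0 : Tendsto u atTop (𝓝 0) :=
    tendsto_zero_of_norm_sq_le (F := fun t => 2 * F t) (fun t => by
      have := sq_nonneg ‖(p t * m t) • w t‖
      simp only [F]
      linarith) (by simpa using hF0.const_mul 2)
  have hqw0 : Tendsto (fun t => (p t * m t) • w t) atTop (𝓝 0) :=
    tendsto_zero_of_norm_sq_le (F := fun t => 8 * F t) (fun t => by
      have := sq_nonneg ‖u t‖
      simp only [F]
      linarith) (by simpa using hF0.const_mul 8)
  have hy0 : Tendsto y atTop (𝓝 0) := by
    have h := hu0.add (hqw0.const_smul (1 / 2 : ℝ))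
    rw [smul_zero, add_zero] at h
    refine h.congr fun t => ?_
    simp only [u, y]
    module
  have hwlim : Tendsto w atTop (𝓝 0) := by
    have hq₀ : 0 < p₀ * (θ * p₀ * β₀) := by positivity
    have hb : Tendsto (fun t => (p₀ * (θ * p₀ * β₀))⁻¹ * ‖(p t * m t) • w t‖) atTop (𝓝 0) := by
      simpa using hqw0.norm.const_mul (p₀ * (θ * p₀ * β₀))⁻¹
    refine squeeze_zero_norm' ?_ hb
    filter_upwards [eventually_ge_atTop t₀] with t ht
    have hpp := hppos t ht
    have hqt : p₀ * (θ * p₀ * β₀) ≤ p t * m t := by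
      have := hp₀p t ht
      have := hβ₀β t ht
      simp only [m]
      gcongr
    rw [← div_eq_inv_mul, le_div_iff₀ hq₀, norm_smul, mul_comm]
    gcongr
    exact hqt.trans (le_abs_self _)
  refine ⟨?_, hwlim⟩
  have hbdd : ∀ᶠ t in atTop, ‖z t - zs‖ ≤ (L + 1) / (c * a / 4) + 1 := by
    filter_upwards [hGL.eventually (gt_mem_nhds (lt_add_one L)), eventually_ge_atTop T] with t h1 h2
    have h3 : ‖z t - zs‖ ^ 2 ≤ (L + 1) / (c * a / 4) := by
      rw [le_div_iff₀ (by positivity), mul_comm]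
      exact (hE t h2).trans h1.le
    nlinarith [sq_nonneg (‖z t - zs‖ - 1)]
  have hyh : Tendsto (fun t => inner ℝ (y t) (z t - zs)) atTop (𝓝 0) := by
    refine squeeze_zero_norm' (a := fun t => ‖y t‖ * ((L + 1) / (c * a / 4) + 1)) ?_ ?_
    · filter_upwards [hbdd] with t ht
      exact (norm_inner_le_norm _ _).trans (by gcongr)
    · simpa using hy0.norm.mul_const ((L + 1) / (c * a / 4) + 1)
  have hαp : Tendsto (fun t => α - p₁ t) atTop (𝓝 (α - ℓ)) := hlim.const_sub α
  have hα0 : α - ℓ ≠ 0 := by linarith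
  refine ⟨_, (((((hGL.sub hF0).sub (hlim.const_mul (c * M / 2))).div_const c).sub hyh).const_mul
    2 |>.div hαp hα0).congr' ?_⟩
  filter_upwards [hαp.eventually_ne hα0] with t ht
  simp only [G, Q, Pi.div_apply]
  field_simp
  ring
end

theorem HasDerivAt.toLp_prodMk {X Y : Type*} [NormedAddCommGroup X] [NormedSpace ℝ X]
    [NormedAddCommGroup Y] [NormedSpace ℝ Y] {x : ℝ → X} {y : ℝ → Y} {x' : X} {y' : Y} {t : ℝ}
    (hx : HasDerivAt x x' t) (hy : HasDerivAt y y' t) :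
    HasDerivAt (fun s => WithLp.toLp 2 (x s, y s)) (WithLp.toLp 2 (x', y')) t :=
  ((WithLp.prodContinuousLinearEquiv 2 ℝ X Y).symm.hasFDerivAt).comp_hasDerivAt t (hx.prodMk hy)

theorem MonotoneOn.hasDerivAt_nonneg_of_Ici {g : ℝ → ℝ} {g' t₀ t : ℝ} (hg : MonotoneOn g (Ici t₀))
    (ht : t₀ ≤ t) (h : HasDerivAt g g' t) : 0 ≤ g' := by
  rw [← h.hasDerivWithinAt.derivWithin (uniqueDiffOn_Ici t₀ t ht)]
  exact hg.derivWithin_nonneg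

theorem tendsto_deriv_rpow_atTop {r : ℝ} (hr : r ≤ 1) :
    Tendsto (fun t : ℝ => r * t ^ (r - 1)) atTop (𝓝 (if r = 1 then 1 else 0)) := by
  split_ifs with h
  · simp [h]
  · have h1 := lt_of_le_of_ne hr h
    simpa using (tendsto_rpow_neg_atTop (sub_pos.2 h1)).const_mul r

section
variable {X Y : Type*} [NormedAddCommGroup X] [InnerProductSpace ℝ X] [CompleteSpace X]
    [NormedAddCommGroup Y] [InnerProductSpace ℝ Y] [CompleteSpace Y]

/-- The saddle operator `(x, l) ↦ (∇f(x) + A* l, b - A x)`. -/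
noncomputable def saddleOperator (f : X → ℝ) (A : X →L[ℝ] Y) (b : Y) (z : WithLp 2 (X × Y)) :
    WithLp 2 (X × Y) :=
  WithLp.toLp 2 (gradient f z.fst + ContinuousLinearMap.adjoint A z.snd, b - A z.fst)

theorem continuous_saddleOperator {f : X → ℝ} (hf : ContDiff ℝ 1 f) (A : X →L[ℝ] Y) (b : Y) :
    Continuous (saddleOperator f A b) := by
  have hg : Continuous (gradient f) :=
    (InnerProductSpace.toDual ℝ X).symm.continuous.comp (hf.continuous_fderiv one_ne_zero)
  unfold saddleOperator
  fun_prop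

theorem saddleOperator_monotone {f : X → ℝ} (hf : Differentiable ℝ f)
    (hconv : ConvexOn ℝ univ f) (A : X →L[ℝ] Y) (b : Y) (z z' : WithLp 2 (X × Y)) :
    0 ≤ inner ℝ (saddleOperator f A b z - saddleOperator f A b z') (z - z') := by
  have h := hconv.inner_gradient_sub_nonneg hf z.fst z'.fst
  refine h.trans_eq ?_
  simp only [saddleOperator, WithLp.prod_inner_apply,
    inner_sub_left, inner_sub_right, inner_add_left, ContinuousLinearMap.adjoint_inner_left,
    WithLp.ofLp_fst, WithLp.ofLp_snd, real_inner_comm _ (A _)]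
  ring

theorem saddleOperator_eq_zero_iff {f : X → ℝ} {A : X →L[ℝ] Y} {b : Y} {z : WithLp 2 (X × Y)} :
    saddleOperator f A b z = 0 ↔
      gradient f z.fst + ContinuousLinearMap.adjoint A z.snd = 0 ∧ A z.fst = b := by
  rw [saddleOperator, WithLp.toLp_eq_zero, Prod.mk_eq_zero, sub_eq_zero, eq_comm (a := b)]

end


/-- if a primal-dual solution exists and `r = 0`, or `r = 1`, or (`r ∈ (0,1)`
and the trajectory is bounded), then `(x(t), λ(t))` converges weakly as `t → ∞` to a
primal-dual solution of the linearly constrained minimization problem. -/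
theorem statement7
    {X Y : Type*} [NormedAddCommGroup X] [InnerProductSpace ℝ X] [CompleteSpace X]
    [NormedAddCommGroup Y] [InnerProductSpace ℝ Y] [CompleteSpace Y]
    (f : X → ℝ) (hf : ContDiff ℝ 1 f) (hconv : ConvexOn ℝ Set.univ f)
    (A : X →L[ℝ] Y) (b : Y)
    (t₀ r α θ : ℝ) (ht₀ : 0 < t₀) (hr0 : 0 ≤ r) (hr1 : r ≤ 1)
    (hα : 0 < α) (hθpos : 0 < θ)
    (hparam : (r < 1 → 2 / α < θ) ∧ (r = 1 → 2 / (α + 1) ≤ θ ∧ θ < 1 / 2))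
    (β β' : ℝ → ℝ)
    (hβpos : ∀ t ∈ Ici t₀, 0 < β t)
    (hβmono : MonotoneOn β (Ici t₀))
    (hβderiv : ∀ t ∈ Ici t₀, HasDerivAt β (β' t) t)
    (hβ'cont : ContinuousOn β' (Ici t₀))
    (hgrowth : ∃ c, c < 1 / θ ∧ ∀ t ∈ Ici t₀, t ^ r * (β' t / β t + 2 * r / t) ≤ c)
    (x x' x'' : ℝ → X) (lam lam' lam'' : ℝ → Y) (wx' : ℝ → X) (wy' : ℝ → Y)
    (hx : ∀ t ∈ Ici t₀, HasDerivAt x (x' t) t)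
    (hx' : ∀ t ∈ Ici t₀, HasDerivAt x' (x'' t) t)
    (hx''cont : ContinuousOn x'' (Ici t₀))
    (hlam : ∀ t ∈ Ici t₀, HasDerivAt lam (lam' t) t)
    (hlam' : ∀ t ∈ Ici t₀, HasDerivAt lam' (lam'' t) t)
    (hlam''cont : ContinuousOn lam'' (Ici t₀))
    (hwx : ∀ t ∈ Ici t₀, HasDerivAt
      (fun s => gradient f (x s) + ContinuousLinearMap.adjoint A (lam s)) (wx' t) t)
    (hwx'cont : ContinuousOn wx' (Ici t₀))
    (hwy : ∀ t ∈ Ici t₀, HasDerivAt (fun s => b - A (x s)) (wy' t) t)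
    (hwy'cont : ContinuousOn wy' (Ici t₀))
    (heqx : ∀ t ∈ Ici t₀,
      x'' t + (α / t ^ r) • x' t + (θ * t ^ r * β t) • wx' t
        + β t • (gradient f (x t) + ContinuousLinearMap.adjoint A (lam t)) = 0)
    (heqy : ∀ t ∈ Ici t₀,
      lam'' t + (α / t ^ r) • lam' t + (θ * t ^ r * β t) • wy' t
        + β t • (b - A (x t)) = 0)
    (hex : ∃ (xs : X) (ls : Y),
      gradient f xs + ContinuousLinearMap.adjoint A ls = 0 ∧ A xs = b)
    (hcase : r = 0 ∨ r = 1 ∨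
      (0 < r ∧ r < 1 ∧ ∃ M : ℝ, ∀ t ∈ Ici t₀, ‖x t‖ ≤ M ∧ ‖lam t‖ ≤ M)) :
    ∃ (xbar : X) (lbar : Y),
      gradient f xbar + ContinuousLinearMap.adjoint A lbar = 0 ∧ A xbar = b ∧
      (∀ φ : X →L[ℝ] ℝ, Tendsto (fun t : ℝ => φ (x t)) atTop (𝓝 (φ xbar))) ∧
      (∀ ψ : Y →L[ℝ] ℝ, Tendsto (fun t : ℝ => ψ (lam t)) atTop (𝓝 (ψ lbar))) := by
  have hfd : Differentiable ℝ f := hf.differentiable one_ne_zero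
  let V := saddleOperator f A b
  let z : ℝ → WithLp 2 (X × Y) := fun t => WithLp.toLp 2 (x t, lam t)
  have hVmono : ∀ a c, 0 ≤ inner ℝ (V a - V c) (a - c) := saddleOperator_monotone hfd hconv A b
  have hz : ∀ t ≥ t₀, HasDerivAt z (WithLp.toLp 2 (x' t, lam' t)) t :=
    fun t ht => (hx t ht).toLp_prodMk (hlam t ht)
  have hw : ∀ t ≥ t₀, HasDerivAt (fun t => V (z t)) (WithLp.toLp 2 (wx' t, wy' t)) t :=
    fun t ht => (hwx t ht).toLp_prodMk (hwy t ht)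
  have hpos : ∀ t ≥ t₀, 0 < t := fun t ht => ht₀.trans_le ht
  have hθlt : r < 1 → 2 * (1 / θ) < α := fun h => by
    have := (div_lt_iff₀ hα).1 (hparam.1 h)
    rw [mul_one_div, div_lt_iff₀ hθpos]
    linarith
  have hθone : r = 1 → 2 * (1 / θ) ≤ α + 1 ∧ 2 < 1 / θ := fun h => by
    have := (div_le_iff₀ (by linarith)).1 (hparam.2 h).1
    rw [mul_one_div, div_le_iff₀ hθpos, lt_div_iff₀ hθpos]
    constructor <;> linarith [(hparam.2 h).2]
  obtain ⟨γ, hγ, hγt⟩ := hgrowth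
  have hasymp : ∀ a, V a = 0 →
      (∃ L, Tendsto (fun t => ‖z t - a‖ ^ 2) atTop (𝓝 L)) ∧
        Tendsto (fun t => V (z t)) atTop (𝓝 0) := by
    intro a ha
    obtain ⟨M, hM0, hM⟩ : ∃ M, 0 ≤ M ∧
        ∀ t ≥ t₀, 0 ≤ r * ((r - 1) * t ^ (r - 1 - 1)) * (‖z t - a‖ ^ 2 - M) := by
      rcases hcase with h | h | ⟨h0, h1, M, hM⟩
      · exact ⟨0, le_rfl, by simp [h]⟩
      · exact ⟨0, le_rfl, by simp [h]⟩
      · refine ⟨(M + M + ‖a‖) ^ 2, sq_nonneg _, fun t ht => mul_nonneg_of_nonpos_of_nonpos ?_ ?_⟩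
        · exact mul_nonpos_of_nonneg_of_nonpos h0.le (mul_nonpos_of_nonpos_of_nonneg
            (by linarith) (Real.rpow_nonneg (hpos t ht).le _))
        · have hzM : ‖z t‖ ≤ M + M := by
            have hsq := WithLp.prod_norm_sq_eq_of_L2 (z t)
            obtain ⟨hxM, hlM⟩ := hM t ht
            have hxM' : ‖(z t).fst‖ ≤ M := hxM
            have hlM' : ‖(z t).snd‖ ≤ M := hlM
            refine abs_le_of_sq_le_sq' ?_ (by linarith [norm_nonneg (x t)]) |>.2
            nlinarith [norm_nonneg (z t).fst, norm_nonneg (z t).snd]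
          have := (norm_sub_le (z t) a).trans (add_le_add_left hzM ‖a‖)
          have := pow_le_pow_left₀ (norm_nonneg _) this 2
          linarith
    refine tendsto_of_inertial_system (α := α) (θ := θ) (ℓ := if r = 1 then 1 else 0) (γ := γ)
      (p₀ := t₀ ^ r) (β₀ := β t₀) (p := fun t => t ^ r) (p₁ := fun t => r * t ^ (r - 1))
      (p₂ := fun t => r * ((r - 1) * t ^ (r - 1 - 1))) (β := β) (β₁ := β')
      (z₁ := fun t => WithLp.toLp 2 (x' t, lam' t)) (z₂ := fun t => WithLp.toLp 2 (x'' t, lam'' t))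
      ht₀ hθpos (by split_ifs <;> norm_num) ?_ ?_ hγ (Real.rpow_pos_of_pos ht₀ r)
      (hβpos t₀ self_mem_Ici) hM0 (fun t ht => Real.rpow_le_rpow ht₀.le ht hr0) ?_
      (fun t ht => Real.hasDerivAt_rpow_const (.inl (hpos t ht).ne'))
      (fun t ht => (Real.hasDerivAt_rpow_const (.inl (hpos t ht).ne')).const_mul r)
      (tendsto_deriv_rpow_atTop hr1) ?_ (fun t ht => hβmono self_mem_Ici ht ht) hβderiv
      (fun t ht => hβmono.hasDerivAt_nonneg_of_Ici ht (hβderiv t ht)) ?_ hz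
      (fun t ht => (hx' t ht).toLp_prodMk (hlam' t ht)) hw ?_
      (fun t ht => inner_deriv_nonneg_of_monotone (hz t ht) (hw t ht) fun s => hVmono _ _)
      (fun t ht => by simpa [ha] using hVmono (z t) a) hM
    · split_ifs with h
      · linarith [(hθone h).1, (hθone h).2]
      · linarith [hθlt (lt_of_le_of_ne hr1 h), one_div_pos.2 hθpos]
    · split_ifs with h
      · linarith [(hθone h).1]
      · linarith [hθlt (lt_of_le_of_ne hr1 h)]
    · filter_upwards [eventually_ge_atTop 1] with t ht
      simpa using Real.rpow_le_rpow_of_exponent_le ht hr1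
    · intro t ht
      split_ifs with h
      · simp [h]
      · exact mul_nonneg hr0 (Real.rpow_nonneg (hpos t ht).le _)
    · intro t ht
      refine le_trans (le_of_eq ?_) (hγt t ht)
      rw [Real.rpow_sub_one (hpos t ht).ne']
      ring
    · intro t ht
      refine (WithLp.ofLp_injective 2) (Prod.ext ?_ ?_)
      · exact heqx t ht
      · exact heqy t ht
  obtain ⟨xs, ls, hs⟩ := hex
  have hs0 : V (WithLp.toLp 2 (xs, ls)) = 0 := saddleOperator_eq_zero_iff.2 hs
  obtain ⟨a, ha, hweak⟩ := exists_weak_limit_of_monotone (continuous_saddleOperator hf A b) hVmono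
    (hasymp _ hs0).2 ⟨_, hs0⟩ fun a ha => (hasymp a ha).1
  obtain ⟨h1, h2⟩ := saddleOperator_eq_zero_iff.1 ha
  refine ⟨a.fst, a.snd, h1, h2, fun φ => ?_, fun ψ => ?_⟩
  · have := hweak (WithLp.toLp 2 ((InnerProductSpace.toDual ℝ X).symm φ, 0))
    simpa [z, WithLp.prod_inner_apply, real_inner_comm ((InnerProductSpace.toDual ℝ X).symm φ)]
      using this
  · have := hweak (WithLp.toLp 2 (0, (InnerProductSpace.toDual ℝ Y).symm ψ))
    simpa [z, WithLp.prod_inner_apply, real_inner_comm ((InnerProductSpace.toDual ℝ Y).symm ψ)]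
      using this
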